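/- arXiv:1802.08532 — 2 statements merged into one kernel-verified Lean document; each statement's English description precedes it below -/
import Mathlib

section
/- Let p be a prime and let E and F be finite-dimensional normed vector spaces over the field ℚ_p of p-adic numbers. Let U ⊆ E be an open subset and let f : U → F be a function which is strictly differentiable at a point v₀ ∈ U, with differential df_{v₀} : E → F a surjective continuous linear map. Then for every real number ρ with 0 < ρ ≤ 1 there exists a real number δ > 0 such that: for every r with 0 < r < δ and every ℤ_p-submodule H of E satisfying B⁻_E(ρr) ⊆ H ⊆ B_E(r) (where B⁻_E(s) = {x ∈ E : ‖x‖ < s} and B_E(s) = {x ∈ E : ‖x‖ ≤ s}), one has v₀ + H ⊆ U and the exact set equality f(v₀ + H) = f(v₀) + df_{v₀}(H), i.e. the image under f of the coset v₀ + H equals the coset of the image lattice df_{v₀}(H) centered at f(v₀). -/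
/-- The precision Lemma (Caruso–Roe–Vaccon): if `f` is strictly differentiable at `v₀ ∈ U`
with surjective differential `f'`, then for every `0 < ρ ≤ 1` there is `δ > 0` such that
for every `0 < r < δ` and every `ℤ_p`-submodule `H` of `E` squeezed between the open ball
of radius `ρ·r` and the closed ball of radius `r`, one has `v₀ + H ⊆ U` and
`f(v₀ + H) = f(v₀) + f'(H)` as sets. -/
theorem precision_lemma
    (p : ℕ) [Fact p.Prime]
    (E : Type*) [NormedAddCommGroup E] [NormedSpace ℚ_[p] E]
    [FiniteDimensional ℚ_[p] E]
    [Module ℤ_[p] E] [IsScalarTower ℤ_[p] ℚ_[p] E]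
    (F : Type*) [NormedAddCommGroup F] [NormedSpace ℚ_[p] F]
    [FiniteDimensional ℚ_[p] F]
    (U : Set E) (hU : IsOpen U) (v₀ : E) (hv₀ : v₀ ∈ U)
    (f : E → F) (f' : E →L[ℚ_[p]] F)
    (hf : HasStrictFDerivAt f f' v₀)
    (hsurj : Function.Surjective f') :
    ∀ ρ : ℝ, 0 < ρ → ρ ≤ 1 →
      ∃ δ : ℝ, 0 < δ ∧
        ∀ r : ℝ, 0 < r → r < δ →
          ∀ H : Submodule ℤ_[p] E,
            Metric.ball (0 : E) (ρ * r) ⊆ (H : Set E) →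
            (H : Set E) ⊆ Metric.closedBall (0 : E) r →
            ((v₀ + ·) '' (H : Set E) ⊆ U ∧
              f '' ((v₀ + ·) '' (H : Set E)) =
                (f v₀ + ·) '' (⇑f' '' (H : Set E))) := by
  intro ρ hρ hρ1
  have : CompleteSpace E := FiniteDimensional.complete ℚ_[p] E
  have : CompleteSpace F := FiniteDimensional.complete ℚ_[p] F
  have hrange : (f' : E →ₗ[ℚ_[p]] F).range = ⊤ := LinearMap.range_eq_top.2 hsurj
  set g := f'.nonlinearRightInverseOfSurjective hrange with hg
  have gpos : 0 < g.nnnorm := f'.nonlinearRightInverseOfSurjective_nnnorm_pos hrange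
  have Npos : (0 : ℝ) < g.nnnorm := gpos
  obtain ⟨c, hc⟩ : ∃ c : NNReal, (c : ℝ) = ρ / (4 * g.nnnorm) :=
    ⟨⟨ρ / (4 * g.nnnorm), by positivity⟩, rfl⟩
  have cpos : (0 : ℝ) < c := by rw [hc]; positivity
  have hcN : (g.nnnorm : ℝ) * c = ρ / 4 := by rw [hc]; field_simp
  have hinv : (g.nnnorm : ℝ) * (g.nnnorm : ℝ)⁻¹ = 1 := mul_inv_cancel₀ Npos.ne'
  obtain ⟨s, hs, happ⟩ := hf.approximates_deriv_on_nhds (c := c) (Or.inr cpos)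
  obtain ⟨η, hη, hball⟩ := Metric.mem_nhds_iff.1 (Filter.inter_mem hs (hU.mem_nhds hv₀))
  refine ⟨η / 2, by positivity, fun r hr hrδ H hH1 hH2 => ?_⟩
  have hnorm : ∀ h ∈ H, ‖h‖ ≤ r := fun h hh => by simpa using hH2 hh
  have hin : ∀ x : E, ‖x - v₀‖ < η → x ∈ s ∧ x ∈ U := fun x hx =>
    hball (by rwa [Metric.mem_ball, dist_eq_norm])
  have hmem : ∀ h ∈ H, v₀ + h ∈ s ∧ v₀ + h ∈ U := fun h hh =>
    hin _ (by have := hnorm h hh; rw [add_sub_cancel_left]; linarith)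
  have herr : ∀ h ∈ H, ‖f (v₀ + h) - f v₀ - f' h‖ ≤ c * r := fun h hh => by
    have h1 := happ (v₀ + h) (hmem h hh).1 v₀ (hin v₀ (by simpa using hη)).1
    rw [add_sub_cancel_left] at h1
    exact h1.trans (mul_le_mul_of_nonneg_left (hnorm h hh) cpos.le)
  refine ⟨?_, Set.Subset.antisymm ?_ ?_⟩
  · rintro _ ⟨h, hh, rfl⟩
    exact (hmem h hh).2
  · rintro _ ⟨_, ⟨h, hh, rfl⟩, rfl⟩
    set e := f (v₀ + h) - f v₀ - f' h with he
    have hge : g e ∈ H := by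
      apply hH1
      rw [mem_ball_zero_iff]
      have h2 : ‖g e‖ ≤ g.nnnorm * ‖e‖ := g.bound e
      have h3 : (g.nnnorm : ℝ) * ‖e‖ ≤ g.nnnorm * (c * r) :=
        mul_le_mul_of_nonneg_left (herr h hh) Npos.le
      rw [← mul_assoc, hcN] at h3
      have : 0 < ρ * r := by positivity
      linarith
    refine ⟨_, ⟨h + g e, H.add_mem hh hge, rfl⟩, ?_⟩
    have : f' (g e) = e := g.right_inv e
    change f v₀ + f' (h + g e) = f (v₀ + h)
    rw [map_add, this, he]
    abel
  · rintro _ ⟨_, ⟨h, hh, rfl⟩, rfl⟩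
    have hρr : 0 < ρ * r := by positivity
    have hρr' : ρ * r ≤ r := by nlinarith
    have hsub : Metric.closedBall (v₀ + h) (ρ * r / 2) ⊆ s := fun x hx => by
      refine (hin x ?_).1
      rw [Metric.mem_closedBall, dist_eq_norm] at hx
      have h1 : ‖x - v₀‖ ≤ ‖x - (v₀ + h)‖ + ‖h‖ := by
        have := norm_add_le (x - (v₀ + h)) h
        rwa [show x - (v₀ + h) + h = x - v₀ by abel] at this
      have := hnorm h hh
      linarith
    have hS := happ.surjOn_closedBall_of_nonlinearRightInverse g
      (by positivity : 0 ≤ ρ * r / 2) hsub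
    have hy : f v₀ + f' h ∈ Metric.closedBall (f (v₀ + h))
        (((g.nnnorm : ℝ)⁻¹ - c) * (ρ * r / 2)) := by
      rw [Metric.mem_closedBall, dist_eq_norm, ← norm_neg,
        show -(f v₀ + f' h - f (v₀ + h)) = f (v₀ + h) - f v₀ - f' h by abel]
      refine (herr h hh).trans ?_
      have h1 : (g.nnnorm : ℝ)⁻¹ * ρ = 4 * c := by rw [hc]; field_simp
      have h2 : (c : ℝ) * (ρ * r) ≤ c * r := mul_le_mul_of_nonneg_left hρr' cpos.le
      have h3 : ((g.nnnorm : ℝ)⁻¹ - c) * (ρ * r / 2)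
          = ((g.nnnorm : ℝ)⁻¹ * ρ) * r / 2 - c * (ρ * r) / 2 := by ring
      rw [h3, h1]
      have : 0 < (c : ℝ) * r := by positivity
      linarith
    obtain ⟨x, hx, hxy⟩ := hS hy
    rw [Metric.mem_closedBall, dist_eq_norm] at hx
    have hxH : x - (v₀ + h) ∈ H := hH1 (by rw [mem_ball_zero_iff]; linarith)
    refine ⟨x, ⟨x - (v₀ + h) + h, H.add_mem hxH hh, ?_⟩, hxy⟩
    simp only
    abel
end

section
/- Let p be a prime, let E = ℚ_p^n with coordinate projections π_i : E → ℚ_p, and let H be a finitely generated lattice in E, i.e. a finitely generated ℤ_p-submodule of E which generates E as a ℚ_p-vector space. Define H₀ = {x ∈ E : π_i(x) ∈ π_i(H) for all i}. Then H ⊆ H₀ and the quotient ℤ_p-module H₀/H has finite length. (This length is the number of diffused digits of precision of H.) -/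
theorem isArtinian_of_fg_of_torsion_aux {R Q : Type*} [CommRing R] [IsDomain R]
    [IsNoetherianRing R] [Ring.KrullDimLE 1 R] [AddCommGroup Q] [Module R Q]
    (ht : ∀ x : Q, ∃ a : R, a ≠ 0 ∧ a • x = 0) (N : Submodule R Q) (hN : N.FG) :
    IsArtinian R N := by
  induction N, hN using Submodule.fg_induction with
  | singleton x =>
    obtain ⟨a, ha, hax⟩ := ht x
    have h1 := (isFiniteLength_iff_isNoetherian_isArtinian.mp
      (isFiniteLength_quotient_span_singleton R (mem_nonZeroDivisors_of_ne_zero ha))).2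
    have hle : Ideal.span {a} ≤ LinearMap.ker (LinearMap.toSpanSingleton R Q x) := by
      rw [Ideal.span_le]
      simpa using hax
    have h2 := isArtinian_range (Submodule.liftQ (Ideal.span {a})
      (LinearMap.toSpanSingleton R Q x) hle)
    rw [Submodule.range_liftQ] at h2
    rwa [LinearMap.range_toSpanSingleton] at h2
  | sup N₁ N₂ _ _ h₁ h₂ => exact isArtinian_sup N₁ N₂

theorem exists_smul_mem_of_mem_span_aux {R K V : Type*} [CommRing R] [IsDomain R] [Field K]
    [Algebra R K] [IsFractionRing R K] [AddCommGroup V] [Module R V] [Module K V]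
    [IsScalarTower R K V] (H : Submodule R V) (x : V)
    (hx : x ∈ Submodule.span K (H : Set V)) : ∃ a : R, a ≠ 0 ∧ a • x ∈ H := by
  induction hx using Submodule.span_induction with
  | mem x h => exact ⟨1, one_ne_zero, by simpa using h⟩
  | zero => exact ⟨1, one_ne_zero, by simp⟩
  | add x y _ _ hx hy =>
    obtain ⟨a, ha, hax⟩ := hx
    obtain ⟨b, hb, hby⟩ := hy
    refine ⟨a * b, mul_ne_zero ha hb, ?_⟩
    rw [smul_add]
    refine H.add_mem ?_ ?_
    · rw [mul_comm, mul_smul]; exact H.smul_mem _ hax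
    · rw [mul_smul]; exact H.smul_mem _ hby
  | smul k x _ hx =>
    obtain ⟨a, ha, hax⟩ := hx
    obtain ⟨c, d, hd, rfl⟩ := IsFractionRing.div_surjective (A := R) k
    have hd0 : algebraMap R K d ≠ 0 := IsFractionRing.to_map_ne_zero_of_mem_nonZeroDivisors hd
    refine ⟨d * a, mul_ne_zero (nonZeroDivisors.ne_zero hd) ha, ?_⟩
    have : (d * a) • ((algebraMap R K c / algebraMap R K d) • x) = c • a • x := by
      rw [← algebraMap_smul K (d * a), ← algebraMap_smul K c, ← algebraMap_smul K a, smul_smul,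
        smul_smul, map_mul]
      congr 1
      field_simp
    rw [this]
    exact H.smul_mem _ hax

/-- For a finitely generated lattice `H` in `ℚ_p^n`, the smallest diagonal module
`H₀ = π₁(H) ⊕ ⋯ ⊕ π_n(H)` contains `H` and the quotient `H₀/H` has finite length as
a `ℤ_p`-module (its length is the number of diffused digits of precision of `H`). -/
theorem diffused_digits_finite_length
    (p : ℕ) [Fact p.Prime] (n : ℕ)
    (H : Submodule ℤ_[p] (Fin n → ℚ_[p])) (hFG : H.FG)
    (hlat : Submodule.span ℚ_[p] (H : Set (Fin n → ℚ_[p])) = ⊤)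
    (H₀ : Submodule ℤ_[p] (Fin n → ℚ_[p]))
    (hH₀ : H₀ = Submodule.pi Set.univ
      (fun i => H.map (LinearMap.proj (R := ℤ_[p]) (φ := fun _ : Fin n => ℚ_[p]) i))) :
    H ≤ H₀ ∧ IsFiniteLength ℤ_[p] (H₀ ⧸ (H.comap H₀.subtype)) := by

  subst hH₀
  refine ⟨?_, ?_⟩
  · intro x hx
    rw [Submodule.mem_pi]
    intro i _
    exact Submodule.mem_map_of_mem hx
  · set H₀ := Submodule.pi Set.univ
      (fun i => H.map (LinearMap.proj (R := ℤ_[p]) (φ := fun _ : Fin n => ℚ_[p]) i)) with hdef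
    have hfg : H₀.FG := Submodule.fg_pi fun i => hFG.map _
    have : Module.Finite ℤ_[p] H₀ := Module.Finite.iff_fg.mpr hfg
    rw [isFiniteLength_iff_isNoetherian_isArtinian]
    refine ⟨inferInstance, ?_⟩
    have h := isArtinian_of_fg_of_torsion_aux (R := ℤ_[p])
      (Q := H₀ ⧸ (H.comap H₀.subtype)) ?_ ⊤ Module.Finite.fg_top
    · exact isArtinian_of_linearEquiv Submodule.topEquiv
    · intro q
      obtain ⟨x, rfl⟩ := Submodule.Quotient.mk_surjective _ q
      obtain ⟨a, ha, hax⟩ := exists_smul_mem_of_mem_span_aux (K := ℚ_[p]) H (x : Fin n → ℚ_[p])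
        (by rw [hlat]; trivial)
      refine ⟨a, ha, ?_⟩
      rw [← Submodule.Quotient.mk_smul, Submodule.Quotient.mk_eq_zero]
      exact hax
end
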